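/- For every k ≥ 2, every Kripke structure K, and every world u ∈ W(K), there exists a Kripke structure K̂ of tree-width ≤ k−1 and a world û ∈ W(K̂) such that K,u ≈ₖ K̂,û (they are k-bisimilar). Furthermore, if K is countable then K̂ has a countable tree decomposition of width ≤ k−1. -/

import Mathlib

set_option linter.unusedVariables false

/-! ## Kripke structures -/

/-- A Kripke structure with worlds `W`, atomic propositions `P` and atomic programs `A`. -/
structure Kripke (W P A : Type) where
  rel : A → W → W → Prop
  val : P → W → Prop

/-! ## Syntax of `CPDL+` with loop and intersection (master language) -/

mutual
  /-- Formulas of loop/intersection CPDL+:  `p | ¬φ | φ∧φ | ⟨π⟩ | loop(π)`. -/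
  inductive PDLFormula : Type where
    | prop  : ℕ → PDLFormula
    | neg   : PDLFormula → PDLFormula
    | conj  : PDLFormula → PDLFormula → PDLFormula
    | diam  : PDLProgram → PDLFormula
    | floop : PDLProgram → PDLFormula
  /-- Programs: `ε | a | ā | π∪π | π∘π | π* | φ? | π∩π | C[x_s,x_t]`. -/
  inductive PDLProgram : Type where
    | eps    : PDLProgram
    | atom   : ℕ → PDLProgram
    | conv   : ℕ → PDLProgram
    | punion : PDLProgram → PDLProgram → PDLProgram
    | comp   : PDLProgram → PDLProgram → PDLProgram
    | star   : PDLProgram → PDLProgram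
    | test   : PDLFormula → PDLProgram
    | inter  : PDLProgram → PDLProgram → PDLProgram
    | cprog  : AtomList → ℕ → ℕ → PDLProgram
  /-- A finite list of atoms `π(x,y)` (a "conjunctive program body" `C`). -/
  inductive AtomList : Type where
    | nil   : AtomList
    | acons : PDLProgram → ℕ → ℕ → AtomList → AtomList
end

/-! ## Semantics -/

mutual
  /-- Satisfaction `⟦φ⟧_K ⊆ W`. -/
  def PDLFormula.sat {W : Type} (K : Kripke W ℕ ℕ) : PDLFormula → W → Prop
    | .prop p, w => K.val p w
    | .neg φ, w => ¬ PDLFormula.sat K φ w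
    | .conj φ ψ, w => PDLFormula.sat K φ w ∧ PDLFormula.sat K ψ w
    | .diam π, w => ∃ v, PDLProgram.rel K π w v
    | .floop π, w => PDLProgram.rel K π w w
  termination_by φ _ => sizeOf φ
  /-- Binary relation `⟦π⟧_K ⊆ W × W`. -/
  def PDLProgram.rel {W : Type} (K : Kripke W ℕ ℕ) : PDLProgram → W → W → Prop
    | .eps, u, v => u = v
    | .atom a, u, v => K.rel a u v
    | .conv a, u, v => K.rel a v u
    | .punion π ρ, u, v => PDLProgram.rel K π u v ∨ PDLProgram.rel K ρ u v
    | .comp π ρ, u, v => ∃ w, PDLProgram.rel K π u w ∧ PDLProgram.rel K ρ w v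
    | .star π, u, v => Relation.ReflTransGen (fun a b => PDLProgram.rel K π a b) u v
    | .test φ, u, v => u = v ∧ PDLFormula.sat K φ u
    | .inter π ρ, u, v => PDLProgram.rel K π u v ∧ PDLProgram.rel K ρ u v
    | .cprog C xs xt, u, v => ∃ f : ℕ → W, f xs = u ∧ f xt = v ∧ AtomList.sat K C f
  termination_by π _ _ => sizeOf π
  /-- `f` is a `C`-satisfying assignment. -/
  def AtomList.sat {W : Type} (K : Kripke W ℕ ℕ) : AtomList → (ℕ → W) → Prop
    | .nil, _ => True
    | .acons π x y C, f => PDLProgram.rel K π (f x) (f y) ∧ AtomList.sat K C f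
  termination_by C _ => sizeOf C
end

/-- Semantic equivalence of formulas (on every Kripke structure). -/
def FormEquiv (φ ψ : PDLFormula) : Prop :=
  ∀ (W : Type) (K : Kripke W ℕ ℕ) (w : W), φ.sat K w ↔ ψ.sat K w

/-- Semantic equivalence of programs (on every Kripke structure). -/
def ProgEquiv (π ρ : PDLProgram) : Prop :=
  ∀ (W : Type) (K : Kripke W ℕ ℕ) (u v : W), π.rel K u v ↔ ρ.rel K u v

/-! ## Graphs (undirected, possibly with self-loops), tree decompositions -/

/-- An undirected graph (self-loop edges are allowed; `adj` is intended symmetric). -/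
structure UGraph (V : Type) where
  verts : Set V
  adj : V → V → Prop

/-- Connectedness of a graph. -/
def UGraph.Connected {V : Type} (G : UGraph V) : Prop :=
  G.verts.Nonempty ∧ ∀ x ∈ G.verts, ∀ y ∈ G.verts, Relation.ReflTransGen G.adj x y

/-- Graph isomorphism (between graphs on possibly different vertex types). -/
def UGraph.Iso {V V' : Type} (G : UGraph V) (H : UGraph V') : Prop :=
  ∃ f : V → V', Set.BijOn f G.verts H.verts ∧
    ∀ x ∈ G.verts, ∀ y ∈ G.verts, (G.adj x y ↔ H.adj (f x) (f y))

/-- A tree decomposition of a (possibly infinite) graph. -/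
structure TreeDecomp {V : Type} (G : UGraph V) where
  ι : Type
  T : SimpleGraph ι
  isTree : T.IsTree
  bag : ι → Set V
  cov_vert : ∀ v ∈ G.verts, ∃ b, v ∈ bag b
  cov_edge : ∀ x y, G.adj x y → ∃ b, x ∈ bag b ∧ y ∈ bag b
  conn : ∀ (v : V) (b b' : ι), v ∈ bag b → v ∈ bag b' →
    Relation.ReflTransGen (fun c c' => T.Adj c c' ∧ v ∈ bag c ∧ v ∈ bag c') b b'

/-- The decomposition has width ≤ k (all bags have at most k+1 elements). -/
def TreeDecomp.WidthLE {V : Type} {G : UGraph V} (td : TreeDecomp G) (k : ℕ) : Prop :=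
  ∀ b, (td.bag b).Finite ∧ (td.bag b).ncard ≤ k + 1

/-- The graph has tree-width ≤ k. -/
def UGraph.TreewidthLE {V : Type} (G : UGraph V) (k : ℕ) : Prop :=
  ∃ td : TreeDecomp G, td.WidthLE k

/-- `TWₖ`: the class of finite graphs of tree-width at most `k`. -/
def TWClass (k : ℕ) : Set (UGraph ℕ) :=
  {G | G.verts.Finite ∧ G.TreewidthLE k}

/-! ## Underlying graphs of conjunctive programs, fragments -/

/-- The list of atoms `(π, x, y)` of `C`. -/
def AtomList.toList : AtomList → List (PDLProgram × ℕ × ℕ)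
  | .nil => []
  | .acons π x y C => (π, x, y) :: C.toList

/-- The variables occurring in `C`. -/
def AtomList.vars (C : AtomList) : Set ℕ :=
  {z | ∃ e ∈ C.toList, z = e.2.1 ∨ z = e.2.2}

/-- The underlying graph `G_C` of a set of atoms `C`. -/
def AtomList.graphC (C : AtomList) : UGraph ℕ where
  verts := C.vars
  adj x y := ∃ e ∈ C.toList, (x = e.2.1 ∧ y = e.2.2) ∨ (x = e.2.2 ∧ y = e.2.1)

/-- The underlying graph `G_{C[x_s,x_t]}`: `G_C` together with the edge `{x_s,x_t}`. -/
def cprogGraph (C : AtomList) (xs xt : ℕ) : UGraph ℕ where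
  verts := C.vars
  adj x y := C.graphC.adj x y ∨ (x = xs ∧ y = xt) ∨ (x = xt ∧ y = xs)

mutual
  /-- Syntactic fragment predicate: `L` allows `loop`, `I` allows `∩`, `N` allows `¬`,
  and every conjunctive program must be well-formed with underlying graph in
  (isomorphic to a member of) the class `𝒢`. -/
  def PDLFormula.OK (L I N : Bool) (𝒢 : Set (UGraph ℕ)) : PDLFormula → Prop
    | .prop _ => True
    | .neg φ => N = true ∧ PDLFormula.OK L I N 𝒢 φ
    | .conj φ ψ => PDLFormula.OK L I N 𝒢 φ ∧ PDLFormula.OK L I N 𝒢 ψ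
    | .diam π => PDLProgram.OK L I N 𝒢 π
    | .floop π => L = true ∧ PDLProgram.OK L I N 𝒢 π
  def PDLProgram.OK (L I N : Bool) (𝒢 : Set (UGraph ℕ)) : PDLProgram → Prop
    | .eps => True
    | .atom _ => True
    | .conv _ => True
    | .punion π ρ => PDLProgram.OK L I N 𝒢 π ∧ PDLProgram.OK L I N 𝒢 ρ
    | .comp π ρ => PDLProgram.OK L I N 𝒢 π ∧ PDLProgram.OK L I N 𝒢 ρ
    | .star π => PDLProgram.OK L I N 𝒢 π
    | .test φ => PDLFormula.OK L I N 𝒢 φ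
    | .inter π ρ => I = true ∧ PDLProgram.OK L I N 𝒢 π ∧ PDLProgram.OK L I N 𝒢 ρ
    | .cprog C xs xt =>
        xs ∈ C.vars ∧ xt ∈ C.vars ∧ (C.graphC).Connected ∧
        (∃ H ∈ 𝒢, (cprogGraph C xs xt).Iso H) ∧ AtomList.OK L I N 𝒢 C
  def AtomList.OK (L I N : Bool) (𝒢 : Set (UGraph ℕ)) : AtomList → Prop
    | .nil => True
    | .acons π _ _ C => PDLProgram.OK L I N 𝒢 π ∧ AtomList.OK L I N 𝒢 C
end

/-- The class of all graphs (no restriction on conjunctive programs). -/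
def FullClass : Set (UGraph ℕ) := Set.univ

/-- The single-vertex graph with a self-loop. -/
def loopGraph : UGraph ℕ := ⟨{0}, fun x y => x = 0 ∧ y = 0⟩

/-- The two-vertex graph with one edge. -/
def capGraph : UGraph ℕ := ⟨{0, 1}, fun x y => (x = 0 ∧ y = 1) ∨ (x = 1 ∧ y = 0)⟩

def GraphLoopClass : Set (UGraph ℕ) := {loopGraph}
def GraphCapClass : Set (UGraph ℕ) := {capGraph}

/-- `CPDL+` formulas: no loop, no intersection, arbitrary conjunctive programs. -/
def IsCPDLPlusFormula (φ : PDLFormula) : Prop := PDLFormula.OK false false true FullClass φ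
def IsCPDLPlusProgram (π : PDLProgram) : Prop := PDLProgram.OK false false true FullClass π
/-- `ICPDL+` formulas: intersection plus arbitrary conjunctive programs. -/
def IsICPDLPlusFormula (φ : PDLFormula) : Prop := PDLFormula.OK false true true FullClass φ
def IsICPDLPlusProgram (π : PDLProgram) : Prop := PDLProgram.OK false true true FullClass π
/-- `ICPDL` formulas: intersection, no conjunctive programs. -/
def IsICPDLFormula (φ : PDLFormula) : Prop := PDLFormula.OK false true true ∅ φ
def IsICPDLProgram (π : PDLProgram) : Prop := PDLProgram.OK false true true ∅ π

/-! ## Underlying graph / tree-width of Kripke structures -/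

/-- `u` is at distance ≤ 1 from `v` in (the underlying undirected graph of) `K`. -/
def Kripke.Near {W P A : Type} (K : Kripke W P A) (u v : W) : Prop :=
  u = v ∨ ∃ a, K.rel a u v ∨ K.rel a v u

/-- The underlying undirected graph of a Kripke structure. -/
def Kripke.graph {W P A : Type} (K : Kripke W P A) : UGraph W :=
  ⟨Set.univ, fun u v => ∃ a, K.rel a u v ∨ K.rel a v u⟩

/-- A Kripke structure has tree-width ≤ k. -/
def Kripke.TreewidthLE {W P A : Type} (K : Kripke W P A) (k : ℕ) : Prop :=
  K.graph.TreewidthLE k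

/-- Every world has finitely many neighbours at distance ≤ 1. -/
def Kripke.FiniteDegree {W P A : Type} (K : Kripke W P A) : Prop :=
  ∀ u : W, {v | K.Near u v}.Finite

/-! ## Pebble games: simulation, half-bisimulation, bisimulation -/

/-- `(x, y) ∈ Homsₖ(K, K')`: the assignment `x i ↦ y i` is a well-defined partial
homomorphism from `K` to `K'`. -/
def IsPHom {W W' P A : Type} (K : Kripke W P A) (K' : Kripke W' P A) {k : ℕ}
    (x : Fin k → W) (y : Fin k → W') : Prop :=
  (∀ i j, x i = x j → y i = y j) ∧
  (∀ (i : Fin k) (p : P), K.val p (x i) → K'.val p (y i)) ∧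
  (∀ (i j : Fin k) (a : A), K.rel a (x i) (x j) → K'.rel a (y i) (y j))

/-- All the worlds of the tuple `x` lie in the same connected component of `K`. -/
def SameComp {W P A : Type} (K : Kripke W P A) {k : ℕ} (x : Fin k → W) : Prop :=
  ∀ i j, Relation.ReflTransGen K.Near (x i) (x j)

/-- `K, u ≼ₖ K', v` (k-simulation): `(s,u,v)` is a valid position of the k-pebble
simulation game, all worlds of `u` are in one connected component of `K`, and Duplicator
has a winning strategy from `(s,u,v)`.  Since the winning condition is a safety condition,
Duplicator wins iff there is an invariant `Z` of Spoiler positions containing `(u,v)`,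
consisting of partial homomorphisms, and closed under Duplicator responses to Spoiler moves. -/
def Sim {W W' P A : Type} (k : ℕ) (K : Kripke W P A) (K' : Kripke W' P A)
    (u : Fin k → W) (v : Fin k → W') : Prop :=
  IsPHom K K' u v ∧ SameComp K u ∧
  ∃ Z : (Fin k → W) → (Fin k → W') → Prop,
    Z u v ∧
    (∀ x y, Z x y → IsPHom K K' x y) ∧
    (∀ x y, Z x y → ∀ (i : Fin k) (w : W), (∃ j, j ≠ i ∧ K.Near w (x j)) →
      ∃ w' : W', (∃ j, j ≠ i ∧ K'.Near w' (y j)) ∧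
        Z (Function.update x i w) (Function.update y i w'))

/-- k-half-bisimulation from `K, u` to `K', v`: as `Sim`, for the k-pebble bisimulation
game, where Spoiler may additionally swap the two structures at positions whose first
tuple is constant.  The invariant consists of two relations: `Z` for positions with
current tuple in `K`, and `Z'` for (swapped) positions with current tuple in `K'`. -/
def HalfBisim {W W' P A : Type} (k : ℕ) (K : Kripke W P A) (K' : Kripke W' P A)
    (u : Fin k → W) (v : Fin k → W') : Prop :=
  IsPHom K K' u v ∧ SameComp K u ∧
  ∃ (Z : (Fin k → W) → (Fin k → W') → Prop)
    (Z' : (Fin k → W') → (Fin k → W) → Prop),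
    Z u v ∧
    (∀ x y, Z x y → IsPHom K K' x y) ∧
    (∀ y x, Z' y x → IsPHom K' K y x) ∧
    (∀ x y, Z x y → ∀ (i : Fin k) (w : W), (∃ j, j ≠ i ∧ K.Near w (x j)) →
      ∃ w' : W', (∃ j, j ≠ i ∧ K'.Near w' (y j)) ∧
        Z (Function.update x i w) (Function.update y i w')) ∧
    (∀ y x, Z' y x → ∀ (i : Fin k) (w' : W'), (∃ j, j ≠ i ∧ K'.Near w' (y j)) →
      ∃ w : W, (∃ j, j ≠ i ∧ K.Near w (x j)) ∧
        Z' (Function.update y i w') (Function.update x i w)) ∧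
    (∀ x y, Z x y → (∀ i j, x i = x j) → Z' y x) ∧
    (∀ y x, Z' y x → (∀ i j, y i = y j) → Z x y)

/-- k-bisimulation `K, u ≈ₖ K', v`: k-half-bisimulations in both directions. -/
def Bisim {W W' P A : Type} (k : ℕ) (K : Kripke W P A) (K' : Kripke W' P A)
    (u : Fin k → W) (v : Fin k → W') : Prop :=
  HalfBisim k K K' u v ∧ HalfBisim k K' K v u

/-- Padding a single world to a `k`-tuple (repeating it). -/
def pad1 {W : Type} (k : ℕ) (v : W) : Fin k → W := fun _ => v

/-- Padding a pair of worlds to a `k`-tuple `(u, v, v, …, v)`. -/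
def pad2 {W : Type} (k : ℕ) (u v : W) : Fin k → W :=
  fun i => if (i : ℕ) = 0 then u else v

/-! ## ML-simulation and the power structures -/

/-- `K', v'` ML-simulates `K, v`. -/
def MLSim {W W' P A : Type} (K : Kripke W P A) (K' : Kripke W' P A) (v : W) (v' : W') : Prop :=
  ∃ Z : W → W' → Prop, Z v v' ∧
    (∀ u u', Z u u' → ∀ p, K.val p u → K'.val p u') ∧
    (∀ u u', Z u u' → ∀ a w, K.rel a u w → ∃ w', K'.rel a u' w' ∧ Z w w')

/-- Atomic propositions of the power structures: `(p,i)`, `(a,i,j)` and `(i,j)`. -/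
abbrev PowProp (k : ℕ) : Type := (ℕ × Fin k) ⊕ (ℕ × Fin k × Fin k) ⊕ (Fin k × Fin k)

/-- The k-power structure `Sₖ(K)`: worlds are k-tuples of worlds of `K`; program `i`
replaces the i-th coordinate by a world at distance ≤ 1 from some other coordinate;
propositions record the atomic information of the tuple. -/
def powerS (k : ℕ) {W : Type} (K : Kripke W ℕ ℕ) : Kripke (Fin k → W) (PowProp k) (Fin k) where
  rel i x y := ∃ w : W, (∃ j, j ≠ i ∧ K.Near w (x j)) ∧ y = Function.update x i w
  val q x :=
    match q with
    | .inl (p, i) => K.val p (x i)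
    | .inr (.inl (a, i, j)) => K.rel a (x i) (x j)
    | .inr (.inr (i, j)) => x i = x j

/-- Atomic programs of `Qₖ(K,K')`: pebble moves `1,…,k` and switching programs `(v₁,v₂)`. -/
abbrev QProg (k : ℕ) (W W' : Type) : Type := Fin k ⊕ (W × W') ⊕ (W' × W)

/-- The structure `Qₖ(K,K')`: worlds `W(K)ᵏ ∪ W(K')ᵏ`, pebble-moving transitions within
each structure, structure-switching transitions between constant tuples, and atomic
propositions recording the atomic information of tuples. -/
def Qk (k : ℕ) {W W' : Type} (K : Kripke W ℕ ℕ) (K' : Kripke W' ℕ ℕ) :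
    Kripke ((Fin k → W) ⊕ (Fin k → W')) (PowProp k) (QProg k W W') where
  rel a x y :=
    match a, x, y with
    | .inl i, .inl u, .inl v =>
        ∃ w : W, (∃ j, j ≠ i ∧ K.Near w (u j)) ∧ v = Function.update u i w
    | .inl i, .inr u, .inr v =>
        ∃ w : W', (∃ j, j ≠ i ∧ K'.Near w (u j)) ∧ v = Function.update u i w
    | .inr (.inl (v₁, v₂)), .inl u, .inr u' => (∀ i, u i = v₁) ∧ (∀ i, u' i = v₂)
    | .inr (.inr (v₁, v₂)), .inr u, .inl u' => (∀ i, u i = v₁) ∧ (∀ i, u' i = v₂)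
    | _, _, _ => False
  val q x :=
    match q, x with
    | .inl (p, i), .inl u => K.val p (u i)
    | .inl (p, i), .inr u => K'.val p (u i)
    | .inr (.inl (a, i, j)), .inl u => K.rel a (u i) (u j)
    | .inr (.inl (a, i, j)), .inr u => K'.rel a (u i) (u j)
    | .inr (.inr (i, j)), .inl u => u i = u j
    | .inr (.inr (i, j)), .inr u => u i = u j

/-- The structure `Q'ₖ(K,K')`: identical to `Qₖ(K,K')` except that the
structure-switching transitions are reversed. -/
def Qk' (k : ℕ) {W W' : Type} (K : Kripke W ℕ ℕ) (K' : Kripke W' ℕ ℕ) :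
    Kripke ((Fin k → W) ⊕ (Fin k → W')) (PowProp k) (QProg k W W') where
  rel a x y :=
    match a with
    | .inl _ => (Qk k K K').rel a x y
    | .inr _ => (Qk k K K').rel a y x
  val := (Qk k K K').val



namespace Unravel

abbrev Move (k : ℕ) (W : Type) : Type := (Fin k × W) ⊕ (Fin k → Fin k)
abbrev Node (k : ℕ) (W : Type) : Type := List (Move k W)
abbrev World (k : ℕ) (W : Type) : Type := Option (Node k W × Fin k × W)

def tup {k : ℕ} {W : Type} : Node k W → Fin k → World k W
  | [] => fun _ => none
  | .inl (i, w) :: t => Function.update (tup t) i (some (t, i, w))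
  | .inr f :: t => fun j => tup t (f j)

def pr {k : ℕ} {W : Type} (u : W) : World k W → W
  | none => u
  | some (_, _, w) => w

def origin {k : ℕ} {W : Type} : World k W → Node k W
  | none => []
  | some (t, i, w) => .inl (i, w) :: t

def KH (k : ℕ) {W : Type} (K : Kripke W ℕ ℕ) (u : W) : Kripke (World k W) ℕ ℕ where
  rel a p q := (∃ t : Node k W, p ∈ Set.range (tup t) ∧ q ∈ Set.range (tup t)) ∧
    K.rel a (pr u p) (pr u q)
  val n p := K.val n (pr u p)

def tree (α : Type) : SimpleGraph (List α) where
  Adj l l' := (∃ m, l = m :: l') ∨ (∃ m, l' = m :: l)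
  symm := ⟨fun _ _ h => h.symm⟩
  loopless := ⟨fun l h => by rcases h with ⟨m, h⟩ | ⟨m, h⟩ <;> simp at h⟩

theorem tree_reach {α : Type} (l : List α) : (tree α).Reachable l [] := by
  induction l with
  | nil => exact SimpleGraph.Reachable.refl _
  | cons m t ih =>
    have : (tree α).Adj (m :: t) t := Or.inl ⟨m, rfl⟩
    exact this.reachable.trans ih

theorem tree_bridge {α : Type} (m : α) (t : List α) :
    ¬ ((tree α).deleteEdges {s(m :: t, t)}).Reachable (m :: t) t := by
  rintro ⟨p⟩
  have key : ∀ (a b : List α), ((tree α).deleteEdges {s(m :: t, t)}).Walk a b →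
      (m :: t) <:+ a → (m :: t) <:+ b := by
    intro a b p
    induction p with
    | nil => exact id
    | cons h _ ih =>
      intro ha
      apply ih
      rw [SimpleGraph.deleteEdges_adj] at h
      obtain ⟨h | h, hne⟩ := h
      · obtain ⟨m', rfl⟩ := h
        rcases List.suffix_cons_iff.1 ha with h1 | h1
        · injection h1 with h1 h2
          subst h1; subst h2
          simp at hne
        · exact h1
      · obtain ⟨m', rfl⟩ := h
        exact ha.trans (List.suffix_cons _ _)
  have := (key _ _ p (List.suffix_refl _)).length_le
  simp at this

theorem tree_isTree (α : Type) : (tree α).IsTree := by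
  refine ⟨⟨fun a b => (tree_reach a).trans (tree_reach b).symm⟩, ?_⟩
  rw [SimpleGraph.isAcyclic_iff_forall_adj_isBridge]
  intro a b h
  rw [SimpleGraph.isBridge_iff]
  rcases h with ⟨m, rfl⟩ | ⟨m, rfl⟩
  · exact tree_bridge m b
  · intro h
    rw [Sym2.eq_swap] at h
    exact tree_bridge m a h.symm

theorem origin_mem {k : ℕ} (hk : 2 ≤ k) {W : Type} (p : World k W) :
    p ∈ Set.range (tup (origin p)) := by
  rcases p with _ | ⟨t, i, w⟩
  · exact ⟨⟨0, by omega⟩, rfl⟩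
  · exact ⟨i, by simp [origin, tup]⟩

abbrev step {k : ℕ} {W : Type} (v : World k W) (c c' : Node k W) : Prop :=
  (tree (Move k W)).Adj c c' ∧ v ∈ Set.range (tup c) ∧ v ∈ Set.range (tup c')

theorem to_origin {k : ℕ} {W : Type} (v : World k W) (l : Node k W)
    (h : v ∈ Set.range (tup l)) : Relation.ReflTransGen (step v) l (origin v) := by
  induction l with
  | nil =>
    obtain ⟨i, rfl⟩ := h
    exact Relation.ReflTransGen.refl
  | cons m t ih =>
    by_cases hv : v ∈ Set.range (tup t)
    · exact Relation.ReflTransGen.head ⟨Or.inl ⟨m, rfl⟩, h, hv⟩ (ih hv)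
    · obtain ⟨j, hj⟩ := h
      rcases m with ⟨i, w⟩ | f
      · by_cases hji : j = i
        · subst hji
          simp [tup] at hj
          subst hj
          exact Relation.ReflTransGen.refl
        · simp [tup, hji] at hj
          exact absurd ⟨j, hj⟩ hv
      · exact absurd ⟨f j, hj⟩ hv

theorem rtg_symm {k : ℕ} {W : Type} (v : World k W) {a b : Node k W}
    (h : Relation.ReflTransGen (step v) a b) : Relation.ReflTransGen (step v) b a := by
  induction h with
  | refl => exact Relation.ReflTransGen.refl
  | tail _ h ih => exact Relation.ReflTransGen.head ⟨h.1.symm, h.2.2, h.2.1⟩ ih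

def decomp {k : ℕ} (hk : 2 ≤ k) {W : Type} (K : Kripke W ℕ ℕ) (u : W) :
    TreeDecomp (KH k K u).graph where
  ι := Node k W
  T := tree _
  isTree := tree_isTree _
  bag t := Set.range (tup t)
  cov_vert v _ := ⟨origin v, origin_mem hk v⟩
  cov_edge x y h := by
    obtain ⟨a, ⟨⟨t, h1, h2⟩, _⟩ | ⟨⟨t, h1, h2⟩, _⟩⟩ := h
    · exact ⟨t, h1, h2⟩
    · exact ⟨t, h2, h1⟩
  conn v b b' h h' := by
    refine (to_origin v b h).trans ?_
    have h2 := to_origin v b' h'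
    exact rtg_symm v h2

theorem decomp_width {k : ℕ} (hk : 2 ≤ k) {W : Type} (K : Kripke W ℕ ℕ) (u : W) :
    (decomp hk K u).WidthLE (k - 1) := by
  intro b
  refine ⟨Set.finite_range _, ?_⟩
  change (Set.range (tup b)).ncard ≤ _
  rw [← Set.image_univ]
  refine (Set.ncard_image_le Set.finite_univ).trans ?_
  simp [Set.ncard_univ]
  omega

def ZZ {k : ℕ} {W : Type} (u : W) (x : Fin k → W) (y : Fin k → World k W) : Prop :=
  x = (fun i => pr u (y i)) ∧ (∃ t, y = tup t) ∧ ∀ i j, pr u (y i) = pr u (y j) → y i = y j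

def ZZ' {k : ℕ} {W : Type} (u : W) (y : Fin k → World k W) (x : Fin k → W) : Prop :=
  x = fun i => pr u (y i)

variable {k : ℕ} {W : Type} (K : Kripke W ℕ ℕ) (u : W)

theorem zz_hom (x : Fin k → W) (y : Fin k → World k W) (h : ZZ u x y) :
    IsPHom K (KH k K u) x y := by
  obtain ⟨rfl, ⟨t, rfl⟩, hi⟩ := h
  exact ⟨hi, fun i p h => h, fun i j a h => ⟨⟨t, ⟨i, rfl⟩, ⟨j, rfl⟩⟩, h⟩⟩

theorem zz'_hom (y : Fin k → World k W) (x : Fin k → W) (h : ZZ' u y x) :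
    IsPHom (KH k K u) K y x := by
  have h : x = fun i => pr u (y i) := h
  subst h
  exact ⟨fun i j h => by simp only [h], fun i p h => h, fun i j a h => h.2⟩

theorem upd_pr (y : Fin k → World k W) (i : Fin k) (w' : World k W) (w : W) (h : pr u w' = w) :
    Function.update (fun i => pr u (y i)) i w = fun j => pr u (Function.update y i w' j) := by
  funext j
  by_cases hj : j = i
  · subst hj; simp [h]
  · simp [hj]

theorem zz'_move (y : Fin k → World k W) (x : Fin k → W) (h : ZZ' u y x) (i : Fin k)
    (w' : World k W) (hn : ∃ j, j ≠ i ∧ (KH k K u).Near w' (y j)) :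
    ∃ w : W, (∃ j, j ≠ i ∧ K.Near w (x j)) ∧
        ZZ' u (Function.update y i w') (Function.update x i w) := by
  have h : x = fun i => pr u (y i) := h
  subst h
  obtain ⟨j, hj, hn⟩ := hn
  refine ⟨pr u w', ⟨j, hj, ?_⟩, upd_pr u y i w' _ rfl⟩
  rcases hn with rfl | ⟨a, h | h⟩
  · exact Or.inl rfl
  · exact Or.inr ⟨a, Or.inl h.2⟩
  · exact Or.inr ⟨a, Or.inr h.2⟩

theorem zz_move (x : Fin k → W) (y : Fin k → World k W) (h : ZZ u x y) (i : Fin k)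
    (w : W) (hn : ∃ j, j ≠ i ∧ K.Near w (x j)) :
    ∃ w' : World k W, (∃ j, j ≠ i ∧ (KH k K u).Near w' (y j)) ∧
        ZZ u (Function.update x i w) (Function.update y i w') := by
  obtain ⟨rfl, ⟨t, rfl⟩, hi⟩ := h
  obtain ⟨j, hj, hn⟩ := hn
  by_cases hw : ∃ j0, pr u (tup t j0) = w
  · obtain ⟨j0, rfl⟩ := hw
    refine ⟨tup t j0, ⟨j, hj, ?_⟩, upd_pr u _ i _ _ rfl, ⟨.inr (Function.update id i j0) :: t, ?_⟩, ?_⟩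
    · rcases hn with h | ⟨a, h | h⟩
      · exact Or.inl (hi _ _ h)
      · exact Or.inr ⟨a, Or.inl ⟨⟨t, ⟨j0, rfl⟩, ⟨j, rfl⟩⟩, h⟩⟩
      · exact Or.inr ⟨a, Or.inr ⟨⟨t, ⟨j, rfl⟩, ⟨j0, rfl⟩⟩, h⟩⟩
    · funext l
      by_cases hl : l = i
      · subst hl; simp [tup]
      · simp [tup, hl]
    · intro a b
      by_cases ha : a = i <;> by_cases hb : b = i <;> simp [Function.update_apply, ha, hb] <;>
        apply hi
  · push Not at hw
    refine ⟨some (t, i, w), ⟨j, hj, ?_⟩, upd_pr u _ i _ _ rfl, ⟨.inl (i, w) :: t, rfl⟩, ?_⟩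
    · have h1 : some (t, i, w) ∈ Set.range (tup (.inl (i, w) :: t)) := ⟨i, by simp [tup]⟩
      have h2 : tup t j ∈ Set.range (tup (.inl (i, w) :: t)) := ⟨j, by simp [tup, hj]⟩
      rcases hn with h | ⟨a, h | h⟩
      · exact absurd h.symm (hw j)
      · exact Or.inr ⟨a, Or.inl ⟨⟨_, h1, h2⟩, h⟩⟩
      · exact Or.inr ⟨a, Or.inr ⟨⟨_, h2, h1⟩, h⟩⟩
    · intro a b
      by_cases ha : a = i <;> by_cases hb : b = i <;> simp only [Function.update_apply, ha, hb, if_true, if_false]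
      · simp
      · intro h; exact absurd h.symm (hw b)
      · intro h; exact absurd h (hw a)
      · apply hi

theorem zz_swap (x : Fin k → W) (y : Fin k → World k W) (h : ZZ u x y) : ZZ' u y x := h.1

theorem zz'_swap (hk : 2 ≤ k) (y : Fin k → World k W) (x : Fin k → W) (h : ZZ' u y x)
    (hc : ∀ i j, y i = y j) : ZZ u x y := by
  refine ⟨h, ?_, fun i j _ => hc i j⟩
  obtain ⟨i0, h0⟩ := origin_mem hk (y ⟨0, by omega⟩)
  refine ⟨.inr (fun _ => i0) :: origin (y ⟨0, by omega⟩), ?_⟩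
  funext j
  rw [hc j ⟨0, by omega⟩]
  exact h0.symm

theorem zz_init : ZZ u (pad1 k u) (pad1 k none) :=
  ⟨rfl, ⟨[], rfl⟩, fun _ _ _ => rfl⟩

theorem bisim (hk : 2 ≤ k) : Bisim k K (KH k K u) (pad1 k u) (pad1 k none) :=
  ⟨⟨zz_hom K u _ _ (zz_init u), fun _ _ => .refl, ZZ u, ZZ' u, zz_init u, zz_hom K u, zz'_hom K u,
      zz_move K u, zz'_move K u, fun x y h _ => zz_swap u x y h, zz'_swap u hk⟩,
    ⟨zz'_hom K u _ _ (zz_init u).1, fun _ _ => .refl, ZZ' u, ZZ u, (zz_init u).1, zz'_hom K u,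
      zz_hom K u, zz'_move K u, zz_move K u, zz'_swap u hk, fun x y h _ => zz_swap u x y h⟩⟩

end Unravel

theorem treewidth_unravelling (k : ℕ) (hk : 2 ≤ k) (W : Type) (K : Kripke W ℕ ℕ) (u : W) :
    ∃ (W' : Type) (K' : Kripke W' ℕ ℕ) (u' : W'),
      K'.TreewidthLE (k-1) ∧
      Bisim k K K' (pad1 k u) (pad1 k u') ∧
      (Countable W → ∃ td : TreeDecomp K'.graph, Countable td.ι ∧ td.WidthLE (k-1)) := by
  refine ⟨Unravel.World k W, Unravel.KH k K u, none,
    ⟨Unravel.decomp hk K u, Unravel.decomp_width hk K u⟩, Unravel.bisim K u hk, fun hW =>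
    ⟨Unravel.decomp hk K u, ?_, Unravel.decomp_width hk K u⟩⟩
  change Countable (List ((Fin k × W) ⊕ (Fin k → Fin k)))
  infer_instance
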